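/- arXiv:2105.05084 — 4 statements merged into one kernel-verified Lean document; each statement's English description precedes it below -/
import Mathlib

section
/- Let k ≥ 1 be an integer, let T be a compact interval in ℝ^k, and let α > 0, p > 0 be such that αp < k. Then there exists a finite constant C such that for all convex subsets F of T, all integers n ≥ 1 and all points y¹, …, yⁿ ∈ F: ∫_F ( Σ_{ℓ=1}^k min_{1≤i≤n} |y_ℓ − y^i_ℓ|² )^{−αp/2} dy ≤ C n^{αp} [λ_k(F)]^{1 − αp/k}, where y = (y₁, …, y_k) and y^i = (y^i₁, …, y^i_k). -/
open MeasureTheory Set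
open scoped ENNReal


lemma aux_finite (k : ℕ) (hk : 1 ≤ k) (a : ℝ) (ha : 0 < a) (hak : a < k) :
    ∫⁻ x in Metric.ball (0 : EuclideanSpace ℝ (Fin k)) 1, ‖x‖ₑ ^ (-a) < ∞ := by
  have : Nonempty (Fin k) := ⟨⟨0, hk⟩⟩
  have h := integrableOn_ball_of_norm_le_rpow (E := EuclideanSpace ℝ (Fin k)) (μ := volume)
    (f := fun x => ‖x‖ ^ (-a)) (C := 1) (α := a) (r := 1) (by simpa using hk) (by simpa using hak)
    (by
      refine Filter.Eventually.of_forall fun x => ?_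
      rw [Real.norm_of_nonneg (by positivity), one_mul])
    (by
      apply Measurable.aestronglyMeasurable
      fun_prop)
  refine lt_of_le_of_lt (le_of_eq ?_) h.2
  apply lintegral_congr_ae
  apply ae_restrict_of_ae
  have h0 : ∀ᵐ x : EuclideanSpace ℝ (Fin k), x ≠ 0 := by
    simp [ae_iff]
  filter_upwards [h0] with x hx
  have hpos : 0 < ‖x‖ := norm_pos_iff.mpr hx
  rw [← ofReal_norm, ← ofReal_norm, Real.norm_of_nonneg (by positivity),
    ENNReal.ofReal_rpow_of_pos hpos]

lemma aux_scale (k : ℕ) (a r : ℝ) (hr : 0 < r) :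
    ∫⁻ x in Metric.ball (0 : EuclideanSpace ℝ (Fin k)) r, ‖x‖ₑ ^ (-a) =
      ENNReal.ofReal (r ^ ((k : ℝ) - a)) *
        ∫⁻ x in Metric.ball (0 : EuclideanSpace ℝ (Fin k)) 1, ‖x‖ₑ ^ (-a) := by
  have hm : Measurable ((Metric.ball (0 : EuclideanSpace ℝ (Fin k)) r).indicator
      (fun x => ‖x‖ₑ ^ (-a))) :=
    Measurable.indicator (by fun_prop) measurableSet_ball
  have h1 := Measure.map_addHaar_smul (volume : Measure (EuclideanSpace ℝ (Fin k))) hr.ne'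
  have h2 : ∫⁻ x, (Metric.ball (0 : EuclideanSpace ℝ (Fin k)) r).indicator
      (fun x => ‖x‖ₑ ^ (-a)) x ∂(Measure.map (r • ·) volume) = _ := lintegral_map hm (by fun_prop)
  rw [h1, lintegral_smul_measure] at h2
  have h3 : ∀ x : EuclideanSpace ℝ (Fin k), (Metric.ball (0 : EuclideanSpace ℝ (Fin k)) r).indicator
      (fun x => ‖x‖ₑ ^ (-a)) (r • x) = ENNReal.ofReal (r ^ (-a)) *
      (Metric.ball (0 : EuclideanSpace ℝ (Fin k)) 1).indicator (fun x => ‖x‖ₑ ^ (-a)) x := by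
    intro x
    have : r • x ∈ Metric.ball (0 : EuclideanSpace ℝ (Fin k)) r ↔
        x ∈ Metric.ball (0 : EuclideanSpace ℝ (Fin k)) 1 := by
      simp only [mem_ball_zero_iff, norm_smul, Real.norm_of_nonneg hr.le]
      constructor <;> intro h <;> nlinarith
    by_cases hx : x ∈ Metric.ball (0 : EuclideanSpace ℝ (Fin k)) 1
    · rw [indicator_of_mem hx, indicator_of_mem (this.2 hx), enorm_smul,
        Real.enorm_eq_ofReal hr.le, ENNReal.mul_rpow_of_ne_top (by simp) (by simp),
        ENNReal.ofReal_rpow_of_pos hr]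
    · rw [indicator_of_notMem hx, indicator_of_notMem (fun h => hx (this.1 h)), mul_zero]
  simp_rw [h3] at h2
  rw [lintegral_const_mul' _ _ (by simp), lintegral_indicator measurableSet_ball,
    lintegral_indicator measurableSet_ball] at h2
  simp only [finrank_euclideanSpace, Fintype.card_fin, smul_eq_mul] at h2
  rw [abs_of_pos (by positivity)] at h2
  have h4 : ENNReal.ofReal (r ^ k) * ENNReal.ofReal ((r ^ k)⁻¹) = 1 := by
    rw [← ENNReal.ofReal_mul (by positivity), mul_inv_cancel₀ (by positivity), ENNReal.ofReal_one]
  rw [sub_eq_add_neg, Real.rpow_add hr, Real.rpow_natCast, ENNReal.ofReal_mul (by positivity),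
    mul_assoc, ← h2, ← mul_assoc, h4, one_mul]

lemma aux_pointwise (k n : ℕ) (hn : 1 ≤ n) (a r : ℝ) (ha : 0 < a) (hr : 0 < r)
    (Y : Fin n → EuclideanSpace ℝ (Fin k)) (y : EuclideanSpace ℝ (Fin k)) :
    (ENNReal.ofReal (∑ ℓ, ⨅ i, (y ℓ - Y i ℓ) ^ 2)) ^ (-(a / 2)) ≤
      ENNReal.ofReal (r ^ (-a)) + ∑ σ : Fin k → Fin n,
        (Metric.ball (0 : EuclideanSpace ℝ (Fin k)) r).indicator (fun x => ‖x‖ₑ ^ (-a))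
          (y - WithLp.toLp 2 (fun ℓ => Y (σ ℓ) ℓ)) := by
  have : Nonempty (Fin n) := ⟨⟨0, hn⟩⟩
  have h1 : ∀ ℓ : Fin k, ∃ i, (y ℓ - Y i ℓ) ^ 2 = ⨅ i, (y ℓ - Y i ℓ) ^ 2 := fun ℓ =>
    exists_eq_ciInf_of_finite
  choose σ hσ using h1
  set z := y - WithLp.toLp 2 (fun ℓ => Y (σ ℓ) ℓ) with hz
  have h2 : ∑ ℓ, ⨅ i, (y ℓ - Y i ℓ) ^ 2 = ‖z‖ ^ 2 := by
    rw [EuclideanSpace.norm_sq_eq]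
    refine Finset.sum_congr rfl fun ℓ _ => ?_
    rw [← hσ ℓ]
    simp [hz]
  have h3 : (ENNReal.ofReal (‖z‖ ^ 2)) ^ (-(a / 2)) = ‖z‖ₑ ^ (-a) := by
    rw [ENNReal.ofReal_pow (norm_nonneg _), ofReal_norm, ← ENNReal.rpow_natCast,
      ← ENNReal.rpow_mul]
    congr 1
    push_cast
    ring
  rw [h2, h3]
  by_cases hzr : z ∈ Metric.ball (0 : EuclideanSpace ℝ (Fin k)) r
  · refine le_trans ?_ le_add_self
    refine le_trans ?_ (Finset.single_le_sum (f := fun σ : Fin k → Fin n =>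
        (Metric.ball (0 : EuclideanSpace ℝ (Fin k)) r).indicator (fun x => ‖x‖ₑ ^ (-a))
          (y - WithLp.toLp 2 (fun ℓ => Y (σ ℓ) ℓ))) (fun _ _ => zero_le) (Finset.mem_univ σ))
    simp only [← hz]
    rw [indicator_of_mem hzr]
  · refine le_trans ?_ le_self_add
    rw [← ENNReal.ofReal_rpow_of_pos hr]
    rw [ENNReal.rpow_neg, ENNReal.rpow_neg, ENNReal.inv_le_inv]
    refine ENNReal.rpow_le_rpow ?_ ha.le
    rw [← ofReal_norm]
    apply ENNReal.ofReal_le_ofReal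
    simpa using hzr

lemma aux_main (k n : ℕ) (hn : 1 ≤ n) (a r : ℝ) (ha : 0 < a) (hr : 0 < r)
    (Y : Fin n → EuclideanSpace ℝ (Fin k)) (F : Set (EuclideanSpace ℝ (Fin k))) :
    (∫⁻ y in F, (ENNReal.ofReal (∑ ℓ, ⨅ i, (y ℓ - Y i ℓ) ^ 2)) ^ (-(a / 2))) ≤
      ENNReal.ofReal (r ^ (-a)) * volume F + (n : ℝ≥0∞) ^ k *
        (ENNReal.ofReal (r ^ ((k : ℝ) - a)) *
        ∫⁻ x in Metric.ball (0 : EuclideanSpace ℝ (Fin k)) 1, ‖x‖ₑ ^ (-a)) := by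
  have hm : Measurable ((Metric.ball (0 : EuclideanSpace ℝ (Fin k)) r).indicator
      (fun x => ‖x‖ₑ ^ (-a))) :=
    Measurable.indicator (by fun_prop) measurableSet_ball
  refine (lintegral_mono fun y => aux_pointwise k n hn a r ha hr Y y).trans ?_
  rw [lintegral_add_left measurable_const, setLIntegral_const]
  gcongr
  refine (setLIntegral_le_lintegral _ _).trans ?_
  rw [lintegral_finsetSum _ (fun σ _ => by
    exact hm.comp (measurable_id.sub_const (WithLp.toLp 2 (fun ℓ => Y (σ ℓ) ℓ))))]
  simp_rw [lintegral_sub_right_eq_self]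
  rw [lintegral_indicator measurableSet_ball, aux_scale k a r hr]
  simp

/-- Lemma 4.3: if `αp < k`, then for every convex subset `F` of a compact interval
`T ⊂ ℝ^k` and all points `y¹, …, yⁿ ∈ F`,
`∫_F (Σ_{ℓ=1}^k min_{1≤i≤n} |y_ℓ − y^i_ℓ|²)^{−αp/2} dy ≤ C n^{αp} λ_k(F)^{1 − αp/k}`. -/
theorem convex_min_integral_estimate
    (k : ℕ) (hk : 1 ≤ k) (α p : ℝ) (hα : 0 < α) (hp : 0 < p)
    (hαp : α * p < k)
    (Ta Tb : Fin k → ℝ) :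
    ∃ C : ℝ, 0 < C ∧
      ∀ F : Set (EuclideanSpace ℝ (Fin k)),
        Convex ℝ F →
        F ⊆ {y : EuclideanSpace ℝ (Fin k) | ∀ ℓ, y ℓ ∈ Icc (Ta ℓ) (Tb ℓ)} →
        ∀ n : ℕ, 1 ≤ n →
          ∀ Y : Fin n → EuclideanSpace ℝ (Fin k),
            (∀ i, Y i ∈ F) →
            (∫⁻ y in F,
                (ENNReal.ofReal (∑ ℓ, ⨅ i, (y ℓ - Y i ℓ) ^ 2)) ^ (-(α * p / 2))) ≤
              ENNReal.ofReal (C * (n : ℝ) ^ (α * p)) *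
                (volume F) ^ (1 - α * p / k) := by
  have ha : 0 < α * p := mul_pos hα hp
  generalize α * p = a at *
  have hk0 : (0 : ℝ) < k := by exact_mod_cast hk
  have hcfin := (aux_finite k hk a ha hαp).ne
  set c := ∫⁻ x in Metric.ball (0 : EuclideanSpace ℝ (Fin k)) 1, ‖x‖ₑ ^ (-a) with hc
  refine ⟨1 + c.toReal, by positivity, ?_⟩
  intro F _ _ n hn Y _
  have hn0 : (0 : ℝ) < n := by exact_mod_cast hn
  have he : 0 < 1 - a / k := by
    rw [sub_pos, div_lt_one hk0]; exact hαp
  by_cases hV0 : volume F = 0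
  · rw [setLIntegral_measure_zero _ _ hV0]
    exact zero_le
  by_cases hVt : volume F = ∞
  · rw [hVt, ENNReal.top_rpow_of_pos he, ENNReal.mul_top]
    · exact le_top
    · rw [Ne, ENNReal.ofReal_eq_zero, not_le]
      positivity
  set v := (volume F).toReal with hv
  have hv0 : 0 < v := ENNReal.toReal_pos hV0 hVt
  have hVv : volume F = ENNReal.ofReal v := (ENNReal.ofReal_toReal hVt).symm
  set r := v ^ (1 / (k : ℝ)) / n with hr
  have hr0 : 0 < r := by positivity
  refine (aux_main k n hn a r ha hr0 Y F).trans (le_of_eq ?_)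
  rw [← hc, hVv, ← ENNReal.ofReal_toReal hcfin, ENNReal.ofReal_rpow_of_pos hv0,
    ← ENNReal.ofReal_natCast, ← ENNReal.ofReal_pow hn0.le, ← ENNReal.ofReal_mul (by positivity),
    ← ENNReal.ofReal_mul (by positivity), ← ENNReal.ofReal_mul (by positivity),
    ← ENNReal.ofReal_add (by positivity) (by positivity), ← ENNReal.ofReal_mul (by positivity),
    ENNReal.toReal_ofReal ENNReal.toReal_nonneg]
  congr 1
  have hra : r ^ (-a) = v ^ (-(a / k)) * (n : ℝ) ^ a := by
    rw [hr, Real.div_rpow (by positivity) hn0.le, ← Real.rpow_mul hv0.le, Real.rpow_neg hn0.le,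
      div_inv_eq_mul]
    congr 2
    ring
  have hrk : (n : ℝ) ^ k * r ^ k = v := by
    rw [← mul_pow, hr, mul_div_cancel₀ _ hn0.ne', ← Real.rpow_natCast, ← Real.rpow_mul hv0.le,
      one_div_mul_cancel hk0.ne', Real.rpow_one]
  have hrka : r ^ ((k : ℝ) - a) = r ^ k * r ^ (-a) := by
    rw [sub_eq_add_neg, Real.rpow_add hr0, Real.rpow_natCast]
  have hve : v ^ (1 - a / k) = v * v ^ (-(a / k)) := by
    rw [sub_eq_add_neg, Real.rpow_add hv0, Real.rpow_one]
  rw [hrka, hve]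
  rw [show (n : ℝ) ^ k * (r ^ k * r ^ (-a) * c.toReal) = ((n : ℝ) ^ k * r ^ k) * r ^ (-a) * c.toReal by ring,
    hrk, hra]
  ring
end

section
/- (Two-sided bound for the conditional variance of fractional Brownian motion.) Let 0 < α < 1 and define R(s, t) = (1/2)(s^{2α} + t^{2α} − |s − t|^{2α}) for s, t ≥ 0 (the covariance of fractional Brownian motion with Hurst index α). Let I ⊂ (0, ∞) be a compact interval and set t⁰ = 0. Then there exist constants 0 < C₁ ≤ C₂ < ∞ such that for every integer n ≥ 1 and all t, t¹, …, tⁿ ∈ I: C₁ min_{0≤i≤n} |t − t^i|^{2α} ≤ inf_{a ∈ ℝⁿ} [ R(t, t) − 2 Σ_{j=1}^n a_j R(t, t^j) + Σ_{i=1}^n Σ_{j=1}^n a_i a_j R(t^i, t^j) ] ≤ C₂ min_{0≤i≤n} |t − t^i|^{2α}. (The infimum equals Var(B(t) | B(t¹), …, B(tⁿ)) for a fractional Brownian motion B with Hurst index α.) -/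
open Set

/-- The covariance `R(s,t) = (1/2)(s^{2α} + t^{2α} − |s−t|^{2α})` of fractional Brownian
motion with Hurst index `α`. -/
noncomputable def fbmCov (α s t : ℝ) : ℝ :=
  (1 / 2) * (s ^ (2 * α) + t ^ (2 * α) - |s - t| ^ (2 * α))

open MeasureTheory in
lemma fbm_integrable (p : ℝ) (hp0 : 0 < p) (hp2 : p < 2) (u : ℝ) :
    IntegrableOn (fun x : ℝ => (1 - Real.cos (u * x)) * x ^ (-1 - p)) (Ioi 0) := by
  have hm : ∀ s : Set ℝ, AEStronglyMeasurable
      (fun x : ℝ => (1 - Real.cos (u * x)) * x ^ (-1 - p)) (volume.restrict s) := by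
    intro s
    apply Measurable.aestronglyMeasurable
    fun_prop
  rw [← Ioc_union_Ioi_eq_Ioi (zero_le_one' ℝ)]
  refine IntegrableOn.union ?_ ?_
  · have h1 : IntegrableOn (fun x : ℝ => u ^ 2 / 2 * x ^ (1 - p)) (Ioc 0 1) := by
      have := (intervalIntegral.intervalIntegrable_rpow' (a := 0) (b := 1) (r := 1 - p)
        (by linarith)).const_mul (u ^ 2 / 2)
      rwa [intervalIntegrable_iff_integrableOn_Ioc_of_le zero_le_one] at this
    refine Integrable.mono' h1 (hm _) ?_
    refine (ae_restrict_iff' measurableSet_Ioc).2 (Filter.Eventually.of_forall ?_)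
    intro x hx
    have hx0 : 0 < x := hx.1
    have hc := Real.one_sub_sq_div_two_le_cos (x := u * x)
    have hc1 := Real.cos_le_one (u * x)
    have hpow : x ^ (1 - p) = x ^ 2 * x ^ (-1 - p) := by
      rw [← Real.rpow_natCast x 2, ← Real.rpow_add hx0]; congr 1; push_cast; ring
    have hpp : 0 < x ^ (-1 - p) := Real.rpow_pos_of_pos hx0 _
    rw [Real.norm_of_nonneg (mul_nonneg (by linarith) hpp.le), hpow, ← mul_assoc]
    apply mul_le_mul_of_nonneg_right _ hpp.le
    nlinarith
  · have h1 : IntegrableOn (fun x : ℝ => 2 * x ^ (-1 - p)) (Ioi 1) :=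
      (integrableOn_Ioi_rpow_of_lt (by linarith) one_pos).const_mul 2
    refine Integrable.mono' h1 (hm _) ?_
    refine (ae_restrict_iff' measurableSet_Ioi).2 (Filter.Eventually.of_forall ?_)
    intro x hx
    have hx0 : 0 < x := lt_trans one_pos hx
    have hc := Real.neg_one_le_cos (u * x)
    have hc1 := Real.cos_le_one (u * x)
    have hpp : 0 < x ^ (-1 - p) := Real.rpow_pos_of_pos hx0 _
    rw [Real.norm_of_nonneg (mul_nonneg (by linarith) hpp.le)]
    apply mul_le_mul_of_nonneg_right _ hpp.le
    linarith

noncomputable def fbmJ (p : ℝ) : ℝ := ∫ x in Ioi (0 : ℝ), (1 - Real.cos x) * x ^ (-1 - p)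

open MeasureTheory in
lemma fbmJ_pos (p : ℝ) (hp0 : 0 < p) (hp2 : p < 2) : 0 < fbmJ p := by
  have hi := fbm_integrable p hp0 hp2 1
  simp only [one_mul] at hi
  have hnn : ∀ x ∈ Ioi (0:ℝ), 0 ≤ (1 - Real.cos x) * x ^ (-1 - p) := fun x hx =>
    mul_nonneg (by linarith [Real.cos_le_one x]) (Real.rpow_nonneg (le_of_lt hx) _)
  unfold fbmJ
  rw [setIntegral_pos_iff_support_of_nonneg_ae
    ((ae_restrict_iff' measurableSet_Ioi).2 (Filter.Eventually.of_forall hnn)) hi]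
  have hsub : Ioo (0:ℝ) 1 ⊆
      (Function.support fun x : ℝ => (1 - Real.cos x) * x ^ (-1 - p)) ∩ Ioi 0 := by
    intro x hx
    refine ⟨?_, hx.1⟩
    have h1 : Real.cos x < 1 := by
      rw [← Real.cos_zero]
      exact Real.cos_lt_cos_of_nonneg_of_le_pi le_rfl (by linarith [hx.2, Real.pi_gt_three]) hx.1
    have h2 := Real.rpow_pos_of_pos hx.1 (-1 - p)
    exact (mul_pos (by linarith) h2).ne'
  refine lt_of_lt_of_le ?_ (measure_mono hsub)
  simp

open MeasureTheory in
lemma fbm_integral (p : ℝ) (hp0 : 0 < p) (u : ℝ) :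
    ∫ x in Ioi (0 : ℝ), (1 - Real.cos (u * x)) * x ^ (-1 - p) = fbmJ p * |u| ^ p := by
  rcases eq_or_ne u 0 with rfl | hu
  · simp [Real.zero_rpow hp0.ne']
  have hu' : 0 < |u| := abs_pos.2 hu
  have h := integral_comp_mul_left_Ioi (fun x : ℝ => (1 - Real.cos x) * x ^ (-1 - p)) 0 hu'
  rw [mul_zero, smul_eq_mul] at h
  have h2 : ∫ x in Ioi (0 : ℝ), (1 - Real.cos (u * x)) * x ^ (-1 - p) =
      |u| ^ (1 + p) * ∫ x in Ioi (0 : ℝ), (1 - Real.cos (|u| * x)) * (|u| * x) ^ (-1 - p) := by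
    rw [← integral_const_mul]
    refine setIntegral_congr_fun measurableSet_Ioi ?_
    intro x hx
    have hx0 : 0 < x := hx
    have hc : Real.cos (|u| * x) = Real.cos (u * x) := by
      rw [← Real.cos_abs (u * x), abs_mul, abs_of_pos hx0]
    have hone : |u| ^ (1 + p) * |u| ^ (-1 - p) = 1 := by
      rw [← Real.rpow_add hu']; simp
    simp only
    rw [hc, Real.mul_rpow hu'.le hx0.le]
    linear_combination (-(1 - Real.cos (u * x)) * x ^ (-1 - p)) * hone
  rw [h2, h, fbmJ, Real.rpow_add hu', Real.rpow_one]
  field_simp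

open MeasureTheory in
lemma fbm_energy {ι : Type*} [Fintype ι] (α : ℝ) (hα0 : 0 < α) (hα1 : α < 1)
    (m s : ι → ℝ) :
    IntegrableOn (fun x : ℝ => ∑ i, ∑ j, -(m i * m j) *
        ((1 - Real.cos ((s i - s j) * x)) * x ^ (-1 - 2 * α))) (Ioi 0) ∧
    ∫ x in Ioi (0:ℝ), ∑ i, ∑ j, -(m i * m j) *
        ((1 - Real.cos ((s i - s j) * x)) * x ^ (-1 - 2 * α)) =
      fbmJ (2 * α) * ∑ i, ∑ j, -(m i * m j) * |s i - s j| ^ (2 * α) := by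
  have hI : ∀ i j, IntegrableOn (fun x : ℝ => -(m i * m j) *
        ((1 - Real.cos ((s i - s j) * x)) * x ^ (-1 - 2 * α))) (Ioi 0) := fun i j =>
    (fbm_integrable (2 * α) (by linarith) (by linarith) (s i - s j)).const_mul _
  refine ⟨integrable_finsetSum _ fun i _ => integrable_finsetSum _ fun j _ => hI i j, ?_⟩
  rw [integral_finsetSum _ (fun i _ => integrable_finsetSum _ fun j _ => hI i j)]
  rw [Finset.mul_sum]
  refine Finset.sum_congr rfl fun i _ => ?_
  rw [integral_finsetSum _ (fun j _ => hI i j), Finset.mul_sum]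
  refine Finset.sum_congr rfl fun j _ => ?_
  rw [integral_const_mul, fbm_integral _ (by linarith)]
  ring

lemma fbm_sq_le {ι : Type*} [Fintype ι] (m s : ι → ℝ) (hm : ∑ i, m i = 0) (t x : ℝ) :
    (∑ i, m i * Real.cos ((s i - t) * x)) ^ 2 ≤
      ∑ i, ∑ j, -(m i * m j) * (1 - Real.cos ((s i - s j) * x)) := by
  have h1 : ∑ i, ∑ j, -(m i * m j) * (1 - Real.cos ((s i - s j) * x)) =
      (∑ i, m i * Real.cos ((s i - t) * x)) ^ 2 + (∑ i, m i * Real.sin ((s i - t) * x)) ^ 2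
        - (∑ i, m i) ^ 2 := by
    simp only [sq, Finset.sum_mul_sum, ← Finset.sum_add_distrib, ← Finset.sum_sub_distrib]
    refine Finset.sum_congr rfl fun i _ => Finset.sum_congr rfl fun j _ => ?_
    have : (s i - s j) * x = (s i - t) * x - (s j - t) * x := by ring
    rw [this, Real.cos_sub]
    ring
  rw [h1, hm]
  nlinarith [sq_nonneg (∑ i, m i * Real.sin ((s i - t) * x))]

open MeasureTheory in
lemma fbm_energy_nonneg {ι : Type*} [Fintype ι] (α : ℝ) (hα0 : 0 < α) (hα1 : α < 1)
    (m s : ι → ℝ) (hm : ∑ i, m i = 0) :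
    0 ≤ ∑ i, ∑ j, -(m i * m j) * |s i - s j| ^ (2 * α) := by
  have h := (fbm_energy α hα0 hα1 m s).2
  have hJ := fbmJ_pos (2 * α) (by linarith) (by linarith)
  refine nonneg_of_mul_nonneg_right ?_ hJ
  rw [← h]
  refine setIntegral_nonneg measurableSet_Ioi fun x hx => ?_
  have h2 := (sq_nonneg _).trans (fbm_sq_le m s hm 0 x)
  have := mul_nonneg h2 (Real.rpow_nonneg (le_of_lt hx) (-1 - 2 * α))
  simpa only [Finset.sum_mul, mul_assoc] using this

open MeasureTheory in
lemma fbm_test {ι : Type*} [Fintype ι] [DecidableEq ι]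
    (m s : ι → ℝ) (i₀ : ι) (t r : ℝ) (hr : 0 < r) (ht : s i₀ = t)
    (hs : ∀ i, i ≠ i₀ → r ≤ |s i - t|) :
    IntegrableOn (fun x : ℝ => (∑ i, m i * Real.cos ((s i - t) * x)) *
        ((1 - Real.cos (r * x)) * x ^ (-1 - 1 : ℝ))) (Ioi 0) ∧
    ∫ x in Ioi (0:ℝ), (∑ i, m i * Real.cos ((s i - t) * x)) *
        ((1 - Real.cos (r * x)) * x ^ (-1 - 1 : ℝ)) = m i₀ * (fbmJ 1 * r) := by
  have hI := fbm_integrable 1 (by norm_num) (by norm_num)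
  have hfun : ∀ x : ℝ, (∑ i, m i * Real.cos ((s i - t) * x)) *
        ((1 - Real.cos (r * x)) * x ^ (-1 - 1 : ℝ)) =
      ∑ i, m i * (((1/2) * ((1 - Real.cos ((s i - t + r) * x)) * x ^ (-1 - 1 : ℝ)) +
        (1/2) * ((1 - Real.cos ((s i - t - r) * x)) * x ^ (-1 - 1 : ℝ))) -
        (1 - Real.cos ((s i - t) * x)) * x ^ (-1 - 1 : ℝ)) := by
    intro x
    rw [Finset.sum_mul]
    refine Finset.sum_congr rfl fun i _ => ?_
    rw [add_mul (s i - t), sub_mul (s i - t), Real.cos_add, Real.cos_sub]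
    ring
  simp only [hfun]
  have hA : ∀ i, IntegrableOn (fun x : ℝ =>
      (1/2) * ((1 - Real.cos ((s i - t + r) * x)) * x ^ (-1 - 1 : ℝ)) +
        (1/2) * ((1 - Real.cos ((s i - t - r) * x)) * x ^ (-1 - 1 : ℝ))) (Ioi 0) := fun i =>
    ((hI _).const_mul _).add ((hI _).const_mul _)
  have hB : ∀ i, IntegrableOn (fun x : ℝ =>
      m i * (((1/2) * ((1 - Real.cos ((s i - t + r) * x)) * x ^ (-1 - 1 : ℝ)) +
        (1/2) * ((1 - Real.cos ((s i - t - r) * x)) * x ^ (-1 - 1 : ℝ))) -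
        (1 - Real.cos ((s i - t) * x)) * x ^ (-1 - 1 : ℝ))) (Ioi 0) := fun i =>
    ((hA i).sub (hI _)).const_mul _
  refine ⟨integrable_finsetSum _ fun i _ => hB i, ?_⟩
  rw [integral_finsetSum _ (fun i _ => hB i)]
  have hval : ∀ i, ∫ x in Ioi (0:ℝ),
      m i * (((1/2) * ((1 - Real.cos ((s i - t + r) * x)) * x ^ (-1 - 1 : ℝ)) +
        (1/2) * ((1 - Real.cos ((s i - t - r) * x)) * x ^ (-1 - 1 : ℝ))) -
        (1 - Real.cos ((s i - t) * x)) * x ^ (-1 - 1 : ℝ)) =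
      m i * (fbmJ 1 * ((1/2) * |s i - t + r| + (1/2) * |s i - t - r| - |s i - t|)) := by
    intro i
    rw [integral_const_mul, integral_sub (hA i) (hI _),
      integral_add ((hI _).const_mul _) ((hI _).const_mul _), integral_const_mul,
      integral_const_mul, fbm_integral 1 one_pos, fbm_integral 1 one_pos, fbm_integral 1 one_pos]
    simp only [Real.rpow_one]
    ring
  simp only [hval]
  rw [Finset.sum_eq_single i₀]
  · rw [ht]; simp only [sub_self, zero_add, zero_sub, abs_neg, abs_zero, abs_of_pos hr]; ring
  · intro i _ hi
    have h := hs i hi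
    have : (1/2) * |s i - t + r| + (1/2) * |s i - t - r| - |s i - t| = 0 := by
      rcases abs_cases (s i - t) with h1 | h1
      · rw [abs_of_nonneg (a := s i - t + r) (by linarith),
          abs_of_nonneg (a := s i - t - r) (by linarith)]; linarith
      · rw [abs_of_nonpos (a := s i - t + r) (by linarith),
          abs_of_nonpos (a := s i - t - r) (by linarith)]; linarith
    rw [this]; ring
  · simp

open MeasureTheory in
lemma fbm_core {ι : Type*} [Fintype ι] [DecidableEq ι] (α : ℝ) (hα0 : 0 < α) (hα1 : α < 1)
    (m s : ι → ℝ) (hm : ∑ i, m i = 0) (i₀ : ι) (t r : ℝ) (hr : 0 < r) (ht : s i₀ = t)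
    (hm1 : m i₀ = 1) (hs : ∀ i, i ≠ i₀ → r ≤ |s i - t|) :
    fbmJ 1 ^ 2 / (2 * fbmJ (2 - 2 * α)) * r ^ (2 * α) ≤
      fbmJ (2 * α) * ∑ i, ∑ j, -(m i * m j) * |s i - s j| ^ (2 * α) := by
  obtain ⟨hE1, hE2⟩ := fbm_energy α hα0 hα1 m s
  obtain ⟨hT1, hT2⟩ := fbm_test m s i₀ t r hr ht hs
  have hW1 := fbm_integrable (2 - 2 * α) (by linarith) (by linarith) r
  have hW2 := fbm_integral (2 - 2 * α) (by linarith) r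
  have hJ' := fbmJ_pos (2 - 2 * α) (by linarith) (by linarith)
  have key : ∀ l : ℝ, 2 * l * (fbmJ 1 * r) ≤
      fbmJ (2 * α) * (∑ i, ∑ j, -(m i * m j) * |s i - s j| ^ (2 * α)) +
        2 * l ^ 2 * (fbmJ (2 - 2 * α) * r ^ (2 - 2 * α)) := by
    intro l
    have h1 : 2 * l * (fbmJ 1 * r) = ∫ x in Ioi (0:ℝ),
        2 * l * ((∑ i, m i * Real.cos ((s i - t) * x)) *
        ((1 - Real.cos (r * x)) * x ^ (-1 - 1 : ℝ))) := by
      rw [integral_const_mul, hT2, hm1, one_mul]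
    rw [abs_of_pos hr] at hW2
    rw [h1, ← hE2, ← hW2, ← integral_const_mul, ← integral_add hE1 (hW1.const_mul _)]
    refine setIntegral_mono_on (hT1.const_mul _) (hE1.add (hW1.const_mul _)) measurableSet_Ioi ?_
    intro x hx
    have hx0 : 0 < x := hx
    have hq := fbm_sq_le m s hm t x
    set h := ∑ i, m i * Real.cos ((s i - t) * x) with hh
    have hP : 0 < x ^ (-1 - 2 * α) := Real.rpow_pos_of_pos hx0 _
    have hV : 0 < x ^ (-1 - (2 - 2 * α)) := Real.rpow_pos_of_pos hx0 _
    have hc0 := Real.cos_le_one (r * x)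
    have hc1 := Real.neg_one_le_cos (r * x)
    have hy : x ^ (-1 - 2 * α) * (x ^ (1 - (2 - 2 * α))) = x ^ (-1 - 1 : ℝ) := by
      rw [← Real.rpow_add hx0]; congr 1; ring
    have hy2 : x ^ (-1 - 2 * α) * (x ^ (1 - (2 - 2 * α)) * x ^ (1 - (2 - 2 * α)))
        = x ^ (-1 - (2 - 2 * α)) := by
      rw [← Real.rpow_add hx0, ← Real.rpow_add hx0]; congr 1; ring
    have hq' : h ^ 2 * x ^ (-1 - 2 * α) ≤ ∑ i, ∑ j, -(m i * m j) *
        ((1 - Real.cos ((s i - s j) * x)) * x ^ (-1 - 2 * α)) := by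
      have := mul_le_mul_of_nonneg_right hq hP.le
      simpa only [Finset.sum_mul, mul_assoc] using this
    refine le_trans ?_ (add_le_add_left hq' _)
    set C := Real.cos (r * x)
    rw [← hy, ← hy2]
    rw [← hy2] at hV
    set P := x ^ (-1 - 2 * α)
    set Y := x ^ (1 - (2 - 2 * α))
    have e1 : 0 ≤ P * (h - l * (1 - C) * Y) ^ 2 := mul_nonneg hP.le (sq_nonneg _)
    have e2 : 0 ≤ l ^ 2 * ((1 - C) * (1 + C)) * (P * (Y * Y)) :=
      mul_nonneg (mul_nonneg (sq_nonneg _) (mul_nonneg (by linarith) (by linarith))) hV.le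
    nlinarith
  have hk := key (fbmJ 1 / (2 * fbmJ (2 - 2 * α)) * r ^ (2 * α - 1))
  have p1 : r ^ (2 * α - 1) * r = r ^ (2 * α) := by
    rw [← Real.rpow_add_one hr.ne']; congr 1; ring
  have p2 : (r ^ (2 * α - 1)) ^ 2 * r ^ (2 - 2 * α) = r ^ (2 * α) := by
    rw [sq, ← Real.rpow_add hr, ← Real.rpow_add hr]; congr 1; ring
  set J' := fbmJ (2 - 2 * α)
  have q1 : 2 * (fbmJ 1 / (2 * J') * r ^ (2 * α - 1)) * (fbmJ 1 * r) =
      2 * (fbmJ 1 ^ 2 / (2 * J') * r ^ (2 * α)) := by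
    rw [← p1]; field_simp
  have q2 : 2 * (fbmJ 1 / (2 * J') * r ^ (2 * α - 1)) ^ 2 * (J' * r ^ (2 - 2 * α)) =
      fbmJ 1 ^ 2 / (2 * J') * r ^ (2 * α) := by
    rw [← p2]; field_simp
  rw [q1, q2] at hk
  linarith

lemma fbm_form {n : ℕ} (α : ℝ) (hα0 : 0 < α) (t : ℝ) (ts : Fin n → ℝ) (ht : 0 < t)
    (hts : ∀ j, 0 < ts j) (c : Fin n → ℝ) :
    let m : Option (Option (Fin n)) → ℝ := fun o => o.elim 1
      (fun o => o.elim (-(1 - ∑ j, c j)) (fun j => - c j))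
    let s : Option (Option (Fin n)) → ℝ := fun o => o.elim t (fun o => o.elim 0 ts)
    ∑ i, m i = 0 ∧ ∑ i, ∑ j, -(m i * m j) * |s i - s j| ^ (2 * α) =
      2 * (fbmCov α t t - 2 * ∑ j, c j * fbmCov α t (ts j) +
                  ∑ i, ∑ j, c i * c j * fbmCov α (ts i) (ts j)) := by
  have hz : (0:ℝ) ^ (2 * α) = 0 := Real.zero_rpow (by linarith)
  intro m s
  constructor
  · simp [m, Fintype.sum_option, Finset.sum_neg_distrib]
    ring
  · simp only [m, s, Fintype.sum_option, Option.elim, fbmCov, sub_self, abs_zero, hz, sub_zero,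
      zero_sub, abs_neg, abs_of_pos ht, abs_of_pos (hts _)]
    have e0 : ∀ j, |ts j - t| = |t - ts j| := fun j => abs_sub_comm _ _
    simp only [e0]
    have e1 : ∑ j, c j * (1 / 2 * (t ^ (2 * α) + ts j ^ (2 * α) - |t - ts j| ^ (2 * α))) =
        1/2 * ((∑ j, c j) * t ^ (2 * α) + ∑ j, c j * ts j ^ (2 * α)
          - ∑ j, c j * |t - ts j| ^ (2 * α)) := by
      rw [Finset.sum_mul, ← Finset.sum_add_distrib, ← Finset.sum_sub_distrib, Finset.mul_sum]
      exact Finset.sum_congr rfl fun j _ => by ring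
    have e2 : ∑ i, ∑ j, c i * c j *
          (1 / 2 * (ts i ^ (2 * α) + ts j ^ (2 * α) - |ts i - ts j| ^ (2 * α))) =
        1/2 * ((∑ j, c j * ts j ^ (2 * α)) * (∑ j, c j) +
          (∑ j, c j) * (∑ j, c j * ts j ^ (2 * α))
          - ∑ i, ∑ j, c i * c j * |ts i - ts j| ^ (2 * α)) := by
      rw [Finset.sum_mul_sum, Finset.sum_mul_sum]
      simp only [← Finset.sum_add_distrib, ← Finset.sum_sub_distrib, Finset.mul_sum]
      exact Finset.sum_congr rfl fun i _ => Finset.sum_congr rfl fun j _ => by ring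
    rw [e1, e2]
    have f1 : ∑ j, -(1 * -c j) * |t - ts j| ^ (2 * α) = ∑ j, c j * |t - ts j| ^ (2 * α) :=
      Finset.sum_congr rfl fun j _ => by ring
    have f2 : ∑ j, -(-(1 - ∑ j, c j) * -c j) * ts j ^ (2 * α) =
        -(1 - ∑ j, c j) * ∑ j, c j * ts j ^ (2 * α) := by
      rw [Finset.mul_sum]
      exact Finset.sum_congr rfl fun j _ => by ring
    have f3 : ∑ i, (-(-c i * 1) * |t - ts i| ^ (2 * α) +
        (-(-c i * -(1 - ∑ j, c j)) * ts i ^ (2 * α) +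
          ∑ j, -(-c i * -c j) * |ts i - ts j| ^ (2 * α))) =
        ∑ j, c j * |t - ts j| ^ (2 * α) + (-(1 - ∑ j, c j) * ∑ j, c j * ts j ^ (2 * α)
          - ∑ i, ∑ j, c i * c j * |ts i - ts j| ^ (2 * α)) := by
      rw [Finset.sum_add_distrib, Finset.sum_add_distrib, Finset.mul_sum, sub_eq_add_neg _ (∑ i, ∑ j, c i * c j * |ts i - ts j| ^ (2 * α))]
      congr 1
      · exact Finset.sum_congr rfl fun j _ => by ring
      congr 1
      · exact Finset.sum_congr rfl fun j _ => by ring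
      rw [← Finset.sum_neg_distrib]
      refine Finset.sum_congr rfl fun i _ => ?_
      rw [← Finset.sum_neg_distrib]
      exact Finset.sum_congr rfl fun j _ => by ring
    rw [f1, f2, f3]
    ring

/-- Lemma 4.5(i): two-sided bound for the conditional variance of fractional Brownian
motion with Hurst index `0 < α < 1`, with the convention `t⁰ = 0`:
`C₁ min_{0≤i≤n} |t − t^i|^{2α} ≤ Var(B(t) | B(t¹), …, B(tⁿ)) ≤ C₂ min_{0≤i≤n} |t − t^i|^{2α}`,
where the conditional variance is the infimum over `a ∈ ℝⁿ` of the quadratic form in the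
covariance `R`. -/
theorem fbm_conditional_variance_two_sided
    (α : ℝ) (hα0 : 0 < α) (hα1 : α < 1)
    (a b : ℝ) (ha : 0 < a) (hab : a ≤ b) :
    ∃ C₁ C₂ : ℝ, 0 < C₁ ∧ C₁ ≤ C₂ ∧
      ∀ n : ℕ, 1 ≤ n →
        ∀ (t : ℝ) (ts : Fin n → ℝ),
          t ∈ Icc a b → (∀ j, ts j ∈ Icc a b) →
          C₁ * min (|t| ^ (2 * α)) (⨅ j, |t - ts j| ^ (2 * α)) ≤
              (⨅ c : Fin n → ℝ,
                (fbmCov α t t - 2 * ∑ j, c j * fbmCov α t (ts j) +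
                  ∑ i, ∑ j, c i * c j * fbmCov α (ts i) (ts j))) ∧
            (⨅ c : Fin n → ℝ,
                (fbmCov α t t - 2 * ∑ j, c j * fbmCov α t (ts j) +
                  ∑ i, ∑ j, c i * c j * fbmCov α (ts i) (ts j))) ≤
              C₂ * min (|t| ^ (2 * α)) (⨅ j, |t - ts j| ^ (2 * α)) := by
  have hJ1 := fbmJ_pos 1 (by norm_num) (by norm_num)
  have hJ2 := fbmJ_pos (2 * α) (by linarith) (by linarith)
  have hJ3 := fbmJ_pos (2 - 2 * α) (by linarith) (by linarith)
  set K := fbmJ 1 ^ 2 / (2 * fbmJ (2 - 2 * α)) with hK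
  have hKpos : 0 < K := by positivity
  refine ⟨K / (2 * fbmJ (2 * α)), max 1 (K / (2 * fbmJ (2 * α))), by positivity,
    le_max_right _ _, ?_⟩
  intro n hn t ts ht hts
  have ht0 : 0 < t := lt_of_lt_of_le ha ht.1
  have hts0 : ∀ j, 0 < ts j := fun j => lt_of_lt_of_le ha (hts j).1
  have : Nonempty (Fin n) := ⟨⟨0, hn⟩⟩
  have hz : (0:ℝ) ^ (2 * α) = 0 := Real.zero_rpow (by linarith)
  have hbdd : BddBelow (range fun j => |t - ts j| ^ (2 * α)) := (finite_range _).bddBelow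
  set M := min (|t| ^ (2 * α)) (⨅ j, |t - ts j| ^ (2 * α)) with hM
  have hM0 : 0 ≤ M := le_min (by positivity) (le_ciInf fun j => by positivity)
  set Q : (Fin n → ℝ) → ℝ := fun c => fbmCov α t t - 2 * ∑ j, c j * fbmCov α t (ts j) +
                  ∑ i, ∑ j, c i * c j * fbmCov α (ts i) (ts j) with hQ
  have hQ0 : ∀ c, 0 ≤ Q c := by
    intro c
    obtain ⟨h1, h2⟩ := fbm_form α hα0 t ts ht0 hts0 c
    have := fbm_energy_nonneg α hα0 hα1 _ (fun o => o.elim t (fun o => o.elim 0 ts)) h1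
    rw [h2] at this
    simp only [hQ]
    linarith
  have hQb : BddBelow (range Q) := ⟨0, by rintro _ ⟨c, rfl⟩; exact hQ0 c⟩
  constructor
  · refine le_ciInf fun c => ?_
    rcases hM0.eq_or_lt with h0 | hpos
    · rw [← h0, mul_zero]; exact hQ0 c
    set r := M ^ (2 * α)⁻¹ with hr
    have hrpos : 0 < r := Real.rpow_pos_of_pos hpos _
    have hrM : r ^ (2 * α) = M := Real.rpow_inv_rpow hM0 (by linarith)
    obtain ⟨h1, h2⟩ := fbm_form α hα0 t ts ht0 hts0 c
    have := fbm_core α hα0 hα1 _ (fun o => o.elim t (fun o => o.elim 0 ts)) h1 none t r hrpos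
      rfl rfl (by
        intro i hi
        rw [← Real.rpow_le_rpow_iff hrpos.le (abs_nonneg _) (z := 2 * α) (by linarith), hrM]
        rcases i with _ | _ | j
        · exact absurd rfl hi
        · exact (min_le_left _ _).trans (by simp)
        · refine (min_le_right _ _).trans ((ciInf_le hbdd j).trans ?_)
          simp [abs_sub_comm])
    rw [h2, hrM] at this
    rw [div_mul_eq_mul_div, div_le_iff₀ (by positivity)]
    calc K * M ≤ _ := this
      _ = _ := by ring
  · have hle : (⨅ c, Q c) ≤ M := by
      refine le_min ?_ (le_ciInf fun k => ?_)
      · refine (ciInf_le hQb 0).trans ?_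
        simp [hQ, fbmCov, hz, abs_of_pos ht0]
        linarith
      · refine (ciInf_le hQb (Pi.single k 1)).trans ?_
        simp [hQ, Pi.single_apply, fbmCov, hz]
        linarith
    calc (⨅ c, Q c) ≤ M := hle
      _ = 1 * M := (one_mul M).symm
      _ ≤ _ := mul_le_mul_of_nonneg_right (le_max_left _ _) hM0
end

section
/- Let I be a compact interval in ℝ. There exists a constant C > 0 such that for every integer n ≥ 2, all t¹, …, tⁿ ∈ I, and every permutation π of {1, …, n}: ∏_{j=2}^n min_{1≤i≤j−1} |t^{π(j)} − t^{π(i)}| ≥ Cⁿ ∏_{j=2}^n min_{1≤i≤j−1} |t^j − t^i|. -/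
open Set

/-- product of consecutive gaps of a list -/
noncomputable def gapProd : List ℝ → ℝ
  | [] => 1
  | [_] => 1
  | a :: b :: l => (b - a) * gapProd (b :: l)

lemma gapProd_nonneg : ∀ l : List ℝ, l.Pairwise (· < ·) → 0 ≤ gapProd l
  | [], _ => by simp [gapProd]
  | [_], _ => by simp [gapProd]
  | a :: b :: l, h => by
    have h1 := (List.pairwise_cons.1 h)
    have h2 := h1.1 b (by simp)
    have h3 := gapProd_nonneg (b :: l) h1.2
    simp only [gapProd]
    exact mul_nonneg (by linarith) h3

lemma gapProd_insert (z m : ℝ) : ∀ (l : List ℝ), l ≠ [] → l.Pairwise (· < ·) → z ∉ l →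
    (∀ y ∈ l, m ≤ |z - y|) → (∃ y ∈ l, m = |z - y|) →
    ∃ l' : List ℝ, l'.Pairwise (· < ·) ∧ (∀ x, x ∈ l' ↔ x = z ∨ x ∈ l) ∧
      (z < l.headD 0 ∨ l'.head? = l.head?) ∧
      gapProd l' ≤ m * gapProd l ∧ m * gapProd l ≤ 2 * gapProd l'
  | [], h, _, _, _, _ => absurd rfl h
  | a :: l, _, hs, hz, hm, ⟨y, hy, hye⟩ => by
    have hs' := List.pairwise_cons.1 hs
    have hG := gapProd_nonneg _ hs
    have hma := hm a (by simp)
    have hza : z ≠ a := by rintro rfl; simp at hz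
    rcases lt_or_gt_of_ne hza with h | h
    · refine ⟨z :: a :: l, ?_, by simp, Or.inl (by simpa using h), ?_⟩
      · refine List.pairwise_cons.2 ⟨?_, hs⟩
        intro x hx
        rcases List.mem_cons.1 hx with rfl | hx
        · exact h
        · exact h.trans (hs'.1 x hx)
      · have hay : a ≤ y := by
          rcases List.mem_cons.1 hy with rfl | hx
          · exact le_rfl
          · exact (hs'.1 y hx).le
        have e : m = a - z := by
          rw [abs_of_neg (by linarith)] at hma hye
          linarith
        subst e
        simp only [gapProd]
        have := mul_nonneg (sub_nonneg.2 h.le) hG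
        constructor <;> linarith
    · rw [abs_of_pos (by linarith)] at hma
      match l with
      | [] =>
        refine ⟨[a, z], by simpa using h, by simp; tauto, Or.inr (by simp), ?_⟩
        have : y = a := by simpa using hy
        subst this
        rw [abs_of_pos (by linarith)] at hye
        simp only [gapProd]
        constructor <;> linarith
      | b :: l =>
        have hab := hs'.1 b (by simp)
        have hs'' := List.pairwise_cons.1 hs'.2
        have hGb := gapProd_nonneg _ hs'.2
        have hmb := hm b (by simp)
        have hzb : z ≠ b := by rintro rfl; simp at hz
        rcases lt_or_gt_of_ne hzb with h2 | h2
        · have hp : (z :: b :: l).Pairwise (· < ·) := by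
            refine List.pairwise_cons.2 ⟨?_, hs'.2⟩
            intro x hx
            rcases List.mem_cons.1 hx with rfl | hx
            · exact h2
            · exact h2.trans (hs''.1 x hx)
          refine ⟨a :: z :: b :: l, ?_, by simp; tauto, Or.inr (by simp), ?_⟩
          · refine List.pairwise_cons.2 ⟨?_, hp⟩
            intro x hx
            rcases List.mem_cons.1 hx with rfl | hx
            · exact h
            · exact hs'.1 x hx
          · rw [abs_of_neg (by linarith)] at hmb
            have hor : m = z - a ∨ b - z ≤ m := by
              rcases List.mem_cons.1 hy with rfl | hx
              · left; rw [hye, abs_of_pos (by linarith)]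
              · right
                have hby : b ≤ y := by
                  rcases List.mem_cons.1 hx with rfl | hx
                  · exact le_rfl
                  · exact (hs''.1 y hx).le
                rw [hye, abs_of_neg (by linarith)]; linarith
            have hm0 : 0 ≤ m := by rw [hye]; positivity
            have k1 : (z - a) * (b - z) ≤ m * (b - a) := by
              rcases hor with e | e
              · subst e; nlinarith
              · nlinarith
            have k2 : m * (b - a) ≤ 2 * ((z - a) * (b - z)) := by
              nlinarith
            simp only [gapProd]
            have := mul_le_mul_of_nonneg_right k1 hGb
            have := mul_le_mul_of_nonneg_right k2 hGb
            constructor <;> linarith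
        · rw [abs_of_pos (by linarith)] at hmb
          have hy' : y ∈ b :: l := by
            rcases List.mem_cons.1 hy with rfl | hx
            · rw [abs_of_pos (by linarith)] at hye
              linarith
            · exact hx
          obtain ⟨l', p1, p2, p3, p4, p5⟩ := gapProd_insert z m (b :: l) (by simp) hs'.2
            (fun hh => hz (List.mem_cons_of_mem _ hh))
            (fun y hy => hm y (List.mem_cons_of_mem _ hy)) ⟨y, hy', hye⟩
          have p3' : l'.head? = some b := by
            rcases p3 with p | p
            · simp at p; linarith
            · simpa using p
          match l', p3' with
          | c :: l', p3' =>
          have : c = b := by simpa using p3'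
          subst this
          refine ⟨a :: c :: l', ?_, ?_, Or.inr (by simp), ?_⟩
          · refine List.pairwise_cons.2 ⟨?_, p1⟩
            intro x hx
            rcases (p2 x).1 hx with rfl | hx
            · exact h
            · exact hs'.1 x hx
          · intro x
            rw [List.mem_cons, p2 x, List.mem_cons (a := x) (b := a)]
            tauto
          · simp only [gapProd]
            have q : 0 ≤ c - a := by linarith
            have := mul_le_mul_of_nonneg_left p4 q
            have := mul_le_mul_of_nonneg_left p5 q
            constructor <;> linarith

lemma prefix_bound (n : ℕ) (s : Fin n → ℝ) (hs : Function.Injective s) (d : Fin n → ℝ)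
    (h1 : ∀ j i, i < j → d j ≤ |s j - s i|)
    (h2 : ∀ j : Fin n, (j : ℕ) ≠ 0 → ∃ i, i < j ∧ d j = |s j - s i|) :
    ∀ k : ℕ, k < n → ∃ l : List ℝ, l.Pairwise (· < ·) ∧
      (∀ x, x ∈ l ↔ ∃ i : Fin n, (i : ℕ) ≤ k ∧ s i = x) ∧
      gapProd l ≤ ∏ j ∈ Finset.univ.filter (fun j : Fin n => (j : ℕ) ≠ 0 ∧ (j : ℕ) ≤ k), d j ∧
      ∏ j ∈ Finset.univ.filter (fun j : Fin n => (j : ℕ) ≠ 0 ∧ (j : ℕ) ≤ k), d j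
        ≤ 2 ^ k * gapProd l := by
  intro k
  induction k with
  | zero =>
    intro hk
    have e : Finset.univ.filter (fun j : Fin n => (j : ℕ) ≠ 0 ∧ (j : ℕ) ≤ 0) = ∅ := by
      ext j; simp
    rw [e]
    refine ⟨[s ⟨0, hk⟩], by simp, ?_, by simp [gapProd], by simp [gapProd]⟩
    intro x
    simp only [List.mem_singleton]
    constructor
    · rintro rfl; exact ⟨⟨0, hk⟩, by simp, rfl⟩
    · rintro ⟨i, hi, rfl⟩
      congr 1
      ext; simpa using hi
  | succ k ih =>
    intro hk
    obtain ⟨l, l1, l2, l3, l4⟩ := ih (by omega)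
    set J : Fin n := ⟨k + 1, hk⟩ with hJ
    have e : Finset.univ.filter (fun j : Fin n => (j : ℕ) ≠ 0 ∧ (j : ℕ) ≤ k + 1) =
        insert J (Finset.univ.filter (fun j : Fin n => (j : ℕ) ≠ 0 ∧ (j : ℕ) ≤ k)) := by
      ext j
      simp only [Finset.mem_filter, Finset.mem_univ, true_and, Finset.mem_insert, Fin.ext_iff, hJ]
      omega
    have hn : J ∉ Finset.univ.filter (fun j : Fin n => (j : ℕ) ≠ 0 ∧ (j : ℕ) ≤ k) := by
      simp [hJ]
    rw [e, Finset.prod_insert hn]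
    obtain ⟨i0, hi0, hd⟩ := h2 J (by simp [hJ])
    have hd0 : 0 ≤ d J := by rw [hd]; positivity
    have hlt : ∀ i : Fin n, i < J ↔ (i : ℕ) ≤ k := by
      intro i; simp only [Fin.lt_def, hJ]; omega
    have hi0l : s i0 ∈ l := (l2 _).2 ⟨i0, (hlt _).1 hi0, rfl⟩
    obtain ⟨l', p1, p2, -, p4, p5⟩ := gapProd_insert (s J) (d J) l
      (List.ne_nil_of_mem hi0l) l1
      (by
        intro hh
        obtain ⟨i, hi, hie⟩ := (l2 _).1 hh
        have := hs hie
        subst this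
        exact lt_irrefl _ ((hlt _).2 hi))
      (by
        intro y hy
        obtain ⟨i, hi, rfl⟩ := (l2 _).1 hy
        exact h1 _ _ ((hlt _).2 hi))
      ⟨_, hi0l, hd⟩
    refine ⟨l', p1, ?_, ?_, ?_⟩
    · intro x
      rw [p2, l2]
      constructor
      · rintro (rfl | ⟨i, hi, rfl⟩)
        · exact ⟨J, by simp [hJ], rfl⟩
        · exact ⟨i, by omega, rfl⟩
      · rintro ⟨i, hi, rfl⟩
        by_cases h : (i : ℕ) ≤ k
        · exact Or.inr ⟨i, h, rfl⟩
        · left; congr 1; ext; simp only [hJ]; omega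
    · exact p4.trans (mul_le_mul_of_nonneg_left l3 hd0)
    · calc _ ≤ d J * (2 ^ k * gapProd l) := mul_le_mul_of_nonneg_left l4 hd0
        _ = 2 ^ k * (d J * gapProd l) := by ring
        _ ≤ 2 ^ k * (2 * gapProd l') := mul_le_mul_of_nonneg_left p5 (by positivity)
        _ = _ := by ring

lemma full_bound (n : ℕ) (hn : 2 ≤ n) (s : Fin n → ℝ) (hs : Function.Injective s) :
    ∃ l : List ℝ, l.Pairwise (· < ·) ∧ (∀ x, x ∈ l ↔ ∃ i : Fin n, s i = x) ∧
      gapProd l ≤ ∏ j ∈ Finset.univ.filter (fun j : Fin n => (j : ℕ) ≠ 0),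
        (⨅ i : {i : Fin n // i < j}, |s j - s i.1|) ∧
      ∏ j ∈ Finset.univ.filter (fun j : Fin n => (j : ℕ) ≠ 0),
        (⨅ i : {i : Fin n // i < j}, |s j - s i.1|) ≤ 2 ^ n * gapProd l := by
  obtain ⟨l, l1, l2, l3, l4⟩ := prefix_bound n s hs
    (fun j => ⨅ i : {i : Fin n // i < j}, |s j - s i.1|)
    (fun j i hij => ciInf_le (Set.finite_range _).bddBelow (⟨i, hij⟩ : {i : Fin n // i < j}))
    (fun j hj => by
      haveI : Nonempty {i : Fin n // i < j} :=
        ⟨⟨⟨0, by omega⟩, by simp only [Fin.lt_def]; omega⟩⟩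
      obtain ⟨i, hi⟩ := exists_eq_ciInf_of_finite (f := fun i : {i : Fin n // i < j} => |s j - s i.1|)
      exact ⟨i.1, i.2, hi.symm⟩)
    (n - 1) (by omega)
  have e : Finset.univ.filter (fun j : Fin n => (j : ℕ) ≠ 0 ∧ (j : ℕ) ≤ n - 1) =
      Finset.univ.filter (fun j : Fin n => (j : ℕ) ≠ 0) := by
    ext j
    simp only [Finset.mem_filter, Finset.mem_univ, true_and]
    omega
  rw [e] at l3 l4
  refine ⟨l, l1, ?_, l3, l4.trans ?_⟩
  · intro x
    rw [l2]
    constructor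
    · rintro ⟨i, -, h⟩; exact ⟨i, h⟩
    · rintro ⟨i, h⟩; exact ⟨i, by omega, h⟩
  · exact mul_le_mul_of_nonneg_right (pow_le_pow_right₀ (by norm_num) (by omega))
      (gapProd_nonneg l l1)

/-- Lemma 4.5(ii): for points `t¹, …, tⁿ` in a compact interval `I ⊂ ℝ` and any
permutation `π` of `{1, …, n}`,
`∏_{j=2}^n min_{1≤i≤j−1} |t^{π(j)} − t^{π(i)}| ≥ Cⁿ ∏_{j=2}^n min_{1≤i≤j−1} |t^j − t^i|`. -/
theorem permuted_min_product_bound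
    (a b : ℝ) (hab : a ≤ b) :
    ∃ C : ℝ, 0 < C ∧
      ∀ n : ℕ, 2 ≤ n →
        ∀ ts : Fin n → ℝ, (∀ j, ts j ∈ Icc a b) →
          ∀ π : Equiv.Perm (Fin n),
            C ^ n *
                ∏ j ∈ Finset.univ.filter (fun j : Fin n => (j : ℕ) ≠ 0),
                  (⨅ i : {i : Fin n // i < j}, |ts j - ts i.1|) ≤
              ∏ j ∈ Finset.univ.filter (fun j : Fin n => (j : ℕ) ≠ 0),
                (⨅ i : {i : Fin n // i < j}, |ts (π j) - ts (π i.1)|) := by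
  refine ⟨1 / 2, by norm_num, ?_⟩
  intro n hn ts _ π
  by_cases hinj : Function.Injective ts
  · obtain ⟨l, l1, l2, -, l4⟩ := full_bound n hn ts hinj
    obtain ⟨l', p1, p2, p3, -⟩ := full_bound n hn (fun j => ts (π j)) (hinj.comp π.injective)
    have hmem : ∀ x, x ∈ l ↔ x ∈ l' := by
      intro x
      rw [l2, p2]
      constructor
      · rintro ⟨i, h⟩; exact ⟨π.symm i, by simpa using h⟩
      · rintro ⟨i, h⟩; exact ⟨π i, h⟩
    have hl : l = l' := by
      have n1 : l.Nodup := l1.imp (fun h => ne_of_lt h)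
      have n2 : l'.Nodup := p1.imp (fun h => ne_of_lt h)
      have hp : l.Perm l' := (List.perm_ext_iff_of_nodup n1 n2).2 hmem
      exact hp.eq_of_pairwise (fun a b _ _ h h' => absurd h (not_lt_of_gt h')) l1 p1
    subst hl
    refine le_trans ?_ p3
    calc _ ≤ (1 / 2 : ℝ) ^ n * (2 ^ n * gapProd l) :=
          mul_le_mul_of_nonneg_left l4 (by positivity)
      _ = gapProd l := by rw [← mul_assoc, ← mul_pow]; norm_num
  · have hR : 0 ≤ ∏ j ∈ Finset.univ.filter (fun j : Fin n => (j : ℕ) ≠ 0),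
        (⨅ i : {i : Fin n // i < j}, |ts (π j) - ts (π i.1)|) :=
      Finset.prod_nonneg fun j _ => Real.iInf_nonneg fun i => abs_nonneg _
    have key : ∃ i j : Fin n, i < j ∧ ts j = ts i := by
      simp only [Function.Injective, not_forall] at hinj
      obtain ⟨x, y, hxy, hne⟩ := hinj
      rcases lt_or_gt_of_ne hne with h | h
      · exact ⟨x, y, h, hxy.symm⟩
      · exact ⟨y, x, h, hxy⟩
    obtain ⟨i, j, hij, he⟩ := key
    rw [Finset.prod_eq_zero (i := j), mul_zero]
    · exact hR
    · simp only [Finset.mem_filter, Finset.mem_univ, true_and]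
      have := Fin.lt_def.1 hij
      omega
    · refine le_antisymm ?_ (Real.iInf_nonneg fun i => abs_nonneg _)
      refine (ciInf_le (Set.finite_range _).bddBelow (⟨i, hij⟩ : {i : Fin n // i < j})).trans ?_
      simp [he]
end

section
/- Let Ĩ ⊂ ℝ be a compact interval. There exists a constant C > 0 such that for every integer n ≥ 2 and all y¹, …, yⁿ ∈ Ĩ: ∏_{j=1}^n min_{1≤i≤n, i≠j} |y^j − y^i| ≥ Cⁿ ∏_{j=2}^n ( min_{1≤i≤j−1} |y^j − y^i| )². -/
open Set

lemma nnpb_le {ι : Type*} [Finite ι] (f : ι → ℝ) (i : ι) : (⨅ i, f i) ≤ f i :=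
  ciInf_le (Set.finite_range f).bddBelow i

lemma nnpb_nn {n : ℕ} (Y : Fin n → ℝ) (j : Fin n) :
    0 ≤ ⨅ i : {i : Fin n // i ≠ j}, |Y j - Y i.1| :=
  Real.iInf_nonneg fun _ => abs_nonneg _

lemma nnpb_q {n : ℕ} (Y : Fin n → ℝ) (y : ℝ) (p : Fin n)
    (hp : ∀ j, |y - Y p| ≤ |y - Y j|) :
    ∃ q : Fin n, ∀ j, j ≠ p → j ≠ q →
      (⨅ i : {i : Fin n // i ≠ j}, |Y j - Y i.1|) ≤ |Y j - y| := by
  classical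
  have same : ∀ j k, j ≠ k → 0 ≤ (Y j - y) * (Y k - y) → |y - Y k| ≤ |y - Y j| →
      (⨅ i : {i : Fin n // i ≠ j}, |Y j - Y i.1|) ≤ |Y j - y| := by
    intro j k hjk hs hd
    refine (nnpb_le (fun i : {i : Fin n // i ≠ j} => |Y j - Y i.1|) ⟨k, hjk.symm⟩).trans ?_
    show |Y j - Y k| ≤ |Y j - y|
    rw [abs_sub_comm y, abs_sub_comm y] at hd
    apply sq_le_sq.mp
    have := sq_le_sq.mpr hd
    have h3 : (Y k - y) ^ 2 ≤ (Y j - y) * (Y k - y) := by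
      have h4 : (Y k - y) ^ 2 = |Y k - y| * |Y k - y| := by rw [← sq, sq_abs]
      rw [h4, ← abs_of_nonneg hs, abs_mul]
      exact mul_le_mul_of_nonneg_right hd (abs_nonneg _)
    nlinarith
  by_cases hS : (Finset.univ.filter (fun j : Fin n => (Y j - y) * (Y p - y) < 0)).Nonempty
  · obtain ⟨q, hq, hmin⟩ := Finset.exists_min_image _ (fun j => |y - Y j|) hS
    simp only [Finset.mem_filter, Finset.mem_univ, true_and] at hq hmin
    refine ⟨q, fun j hjp hjq => ?_⟩
    by_cases h : (Y j - y) * (Y p - y) < 0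
    · refine same j q hjq ?_ (hmin j h)
      by_contra hc
      push Not at hc
      have h1 := mul_pos_of_neg_of_neg h hq
      nlinarith [mul_nonneg (neg_nonneg.mpr hc.le) (sq_nonneg (Y p - y))]
    · exact same j p hjp (not_lt.mp h) (hp j)
  · refine ⟨p, fun j hjp _ => same j p hjp ?_ (hp j)⟩
    by_contra hc
    push Not at hc
    exact hS ⟨j, by simpa using hc⟩

lemma nnpb_step {n : ℕ} (L : ℝ) (hL : 0 < L) (Y : Fin (n + 3) → ℝ)
    (hY : ∀ i j, |Y i - Y j| ≤ L) :
    (∏ j : Fin (n + 2), ⨅ i : {i : Fin (n + 2) // i ≠ j}, |Y j.castSucc - Y i.1.castSucc|) *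
      ((1 / (2 * L)) *
        (⨅ i : {i : Fin (n + 3) // i < Fin.last (n + 2)}, |Y (Fin.last _) - Y i.1|) ^ 2) ≤
    ∏ j : Fin (n + 3), ⨅ i : {i : Fin (n + 3) // i ≠ j}, |Y j - Y i.1| := by
  classical
  obtain ⟨p, hp⟩ := Finite.exists_min (fun j : Fin (n + 2) => |Y (Fin.last _) - Y j.castSucc|)
  obtain ⟨q, hq⟩ := nnpb_q (fun j : Fin (n + 2) => Y j.castSucc) (Y (Fin.last _)) p hp
  set y := Y (Fin.last (n + 2)) with hy
  have hne : Nonempty {i : Fin (n + 3) // i < Fin.last (n + 2)} := ⟨⟨p.castSucc, p.castSucc_lt_last⟩⟩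
  set d := ⨅ i : {i : Fin (n + 3) // i < Fin.last (n + 2)}, |y - Y i.1| with hd
  have hdp : d = |y - Y p.castSucc| := by
    apply le_antisymm
    · exact nnpb_le (fun i : {i : Fin (n + 3) // i < Fin.last (n + 2)} => |y - Y i.1|)
        ⟨p.castSucc, p.castSucc_lt_last⟩
    · refine le_ciInf fun ⟨i, hi⟩ => ?_
      obtain ⟨k, rfl⟩ := Fin.exists_castSucc_eq.mpr hi.ne
      exact hp k
  have hd0 : 0 ≤ d := hdp ▸ abs_nonneg _
  have hdL : d ≤ L := hdp ▸ hY _ _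
  have hlast : d ≤ ⨅ i : {i : Fin (n + 3) // i ≠ Fin.last (n + 2)}, |y - Y i.1| := by
    have : Nonempty {i : Fin (n + 3) // i ≠ Fin.last (n + 2)} :=
      ⟨⟨p.castSucc, p.castSucc_lt_last.ne⟩⟩
    refine le_ciInf fun ⟨i, hi⟩ => ?_
    obtain ⟨k, rfl⟩ := Fin.exists_castSucc_eq.mpr hi
    rw [hdp]; exact hp k
  set M : Fin (n + 2) → ℝ := fun j =>
    ⨅ i : {i : Fin (n + 2) // i ≠ j}, |Y j.castSucc - Y i.1.castSucc| with hM
  have hM0 : ∀ j, 0 ≤ M j := fun j => nnpb_nn (fun j : Fin (n + 2) => Y j.castSucc) j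
  have hMle : ∀ j k, k ≠ j → M j ≤ |Y j.castSucc - Y k.castSucc| := fun j k h =>
    nnpb_le (fun i : {i : Fin (n + 2) // i ≠ j} => |Y j.castSucc - Y i.1.castSucc|) ⟨k, h⟩
  have hML : ∀ j, M j ≤ L := fun j => by
    obtain ⟨k, hk⟩ := exists_ne j
    exact (hMle j k hk).trans (hY _ _)
  have hnew : ∀ j : Fin (n + 2), min (M j) |Y j.castSucc - y| ≤
      ⨅ i : {i : Fin (n + 3) // i ≠ j.castSucc}, |Y j.castSucc - Y i.1| := by
    intro j
    have : Nonempty {i : Fin (n + 3) // i ≠ j.castSucc} := ⟨⟨Fin.last _, j.castSucc_lt_last.ne'⟩⟩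
    refine le_ciInf fun ⟨i, hi⟩ => ?_
    by_cases h : i = Fin.last _
    · subst h; exact min_le_right _ _
    · obtain ⟨k, rfl⟩ := Fin.exists_castSucc_eq.mpr h
      exact (min_le_left _ _).trans (hMle j k (fun h => hi (by rw [h])))
  have hdL1 : d / L ≤ 1 := (div_le_one hL).mpr hdL
  have hdL0 : 0 ≤ d / L := by positivity
  have hw : ∀ j : Fin (n + 2), M j * ((if j = p then d / L else 1) * (if j = q then 1 / 2 else 1)) ≤
      ⨅ i : {i : Fin (n + 3) // i ≠ j.castSucc}, |Y j.castSucc - Y i.1| := by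
    intro j
    refine le_trans (le_min ?_ ?_) (hnew j)
    · refine mul_le_of_le_one_right (hM0 j) ?_
      split_ifs <;> linarith
    · by_cases h : j = p
      · have h2 : |Y j.castSucc - y| = d := by rw [h, hdp, abs_sub_comm]
        have h3 : M j * (d / L) ≤ d := by
          rw [mul_div_assoc', div_le_iff₀ hL, mul_comm]
          exact mul_le_mul_of_nonneg_left (hML j) hd0
        have h4 : 0 ≤ M j * (d / L) := mul_nonneg (hM0 j) hdL0
        rw [h2, if_pos h, ← mul_assoc]
        split_ifs <;> linarith
      · rw [if_neg h]
        by_cases h' : j = q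
        · rw [if_pos h']
          have h1 := hMle j p (Ne.symm h)
          have h2 : |Y p.castSucc - y| ≤ |Y j.castSucc - y| := by
            have := hp j
            rwa [abs_sub_comm y, abs_sub_comm y] at this
          have h3 := abs_sub_le (Y j.castSucc) y (Y p.castSucc)
          rw [abs_sub_comm y] at h3
          linarith
        · rw [if_neg h']
          simpa using hq j h h'
  rw [Fin.prod_univ_castSucc (n := n + 2)]
  have hprod := Finset.prod_le_prod (s := Finset.univ) (fun j _ => mul_nonneg (hM0 j)
    (show (0:ℝ) ≤ (if j = p then d / L else 1) * (if j = q then 1 / 2 else 1) by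
      split_ifs <;> linarith)) (fun j _ => hw j)
  rw [Finset.prod_mul_distrib, Finset.prod_mul_distrib, Finset.prod_ite_eq', Finset.prod_ite_eq',
    if_pos (Finset.mem_univ _), if_pos (Finset.mem_univ _)] at hprod
  have hP0 : 0 ≤ ∏ j, M j := Finset.prod_nonneg fun j _ => hM0 j
  calc _ = ((∏ j, M j) * (d / L * (1 / 2))) * d := by field_simp
    _ ≤ _ := mul_le_mul hprod hlast hd0 (Finset.prod_nonneg fun j _ => nnpb_nn Y _)

lemma nnpb_ind (L : ℝ) (hL : 0 < L) (n : ℕ) : ∀ (Y : Fin (n + 2) → ℝ)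
    (_ : ∀ i j, |Y i - Y j| ≤ L),
    (1 / (2 * L)) ^ n * (∏ j : Fin (n + 2), if (j : ℕ) ≠ 0 then
      (⨅ i : {i : Fin (n + 2) // i < j}, |Y j - Y i.1|) ^ 2 else 1) ≤
    ∏ j : Fin (n + 2), ⨅ i : {i : Fin (n + 2) // i ≠ j}, |Y j - Y i.1| := by
  induction n with
  | zero =>
    intro Y hY
    have h1 : (⨅ i : {i : Fin 2 // i < 1}, |Y 1 - Y i.1|) ≤ |Y 1 - Y 0| :=
      nnpb_le (fun i : {i : Fin 2 // i < 1} => |Y 1 - Y i.1|) ⟨0, by decide⟩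
    have h0 : 0 ≤ ⨅ i : {i : Fin 2 // i < 1}, |Y 1 - Y i.1| :=
      Real.iInf_nonneg fun _ => abs_nonneg _
    have h2 : |Y 1 - Y 0| ≤ ⨅ i : {i : Fin 2 // i ≠ 0}, |Y 0 - Y i.1| := by
      have : Nonempty {i : Fin 2 // i ≠ 0} := ⟨⟨1, by decide⟩⟩
      refine le_ciInf fun ⟨i, hi⟩ => ?_
      have : i = 1 := by omega
      subst this; rw [abs_sub_comm]
    have h3 : |Y 1 - Y 0| ≤ ⨅ i : {i : Fin 2 // i ≠ 1}, |Y 1 - Y i.1| := by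
      have : Nonempty {i : Fin 2 // i ≠ 1} := ⟨⟨0, by decide⟩⟩
      refine le_ciInf fun ⟨i, hi⟩ => ?_
      have : i = 0 := by omega
      subst this; exact le_rfl
    rw [Fin.prod_univ_two, Fin.prod_univ_two, if_neg (by simp), if_pos (by simp), pow_zero, one_mul,
      one_mul, sq]
    exact mul_le_mul (h1.trans h2) (h1.trans h3) h0 (nnpb_nn Y 0)
  | succ n ih =>
    intro Y hY
    refine le_trans ?_ (nnpb_step L hL Y hY)
    have h := ih (fun j => Y j.castSucc) (fun i j => hY _ _)
    rw [Fin.prod_univ_castSucc (n := n + 2), if_pos (by simp)]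
    set d := ⨅ i : {i : Fin (n + 3) // i < Fin.last (n + 2)}, |Y (Fin.last _) - Y i.1| with hd
    have hc : 0 ≤ 1 / (2 * L) := by positivity
    have key : (∏ j : Fin (n + 2), if ((j.castSucc : Fin (n + 3)) : ℕ) ≠ 0 then
        (⨅ i : {i : Fin (n + 3) // i < j.castSucc}, |Y j.castSucc - Y i.1|) ^ 2 else 1) ≤
        ∏ j : Fin (n + 2), if (j : ℕ) ≠ 0 then
      (⨅ i : {i : Fin (n + 2) // i < j}, |Y j.castSucc - Y i.1.castSucc|) ^ 2 else 1 := by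
      refine Finset.prod_le_prod (fun j _ => by split_ifs <;> positivity) (fun j _ => ?_)
      rw [Fin.val_castSucc]
      split_ifs with h0
      · have : Nonempty {i : Fin (n + 2) // i < j} := ⟨⟨0, by
          rw [Fin.lt_def]; simpa using Nat.pos_of_ne_zero h0⟩⟩
        refine pow_le_pow_left₀ (Real.iInf_nonneg fun _ => abs_nonneg _) ?_ 2
        refine le_ciInf fun ⟨i, hi⟩ => ?_
        exact nnpb_le (fun i : {i : Fin (n + 3) // i < j.castSucc} => |Y j.castSucc - Y i.1|)
          ⟨i.castSucc, by simpa using hi⟩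
      · exact le_rfl
    have h5 := (mul_le_mul_of_nonneg_left key (pow_nonneg hc n)).trans h
    have h6 := mul_le_mul_of_nonneg_right h5 (mul_nonneg hc (sq_nonneg d))
    refine le_trans (le_of_eq ?_) h6
    rw [pow_succ]; ring

/-- The elementary inequality used in the proof of Lemma 4.7: for points `y¹, …, yⁿ` in a
compact interval `Ĩ ⊂ ℝ`,
`∏_{j=1}^n min_{i≠j} |y^j − y^i| ≥ Cⁿ ∏_{j=2}^n (min_{1≤i≤j−1} |y^j − y^i|)²`. -/
theorem nearest_neighbor_product_bound
    (a b : ℝ) (hab : a ≤ b) :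
    ∃ C : ℝ, 0 < C ∧
      ∀ n : ℕ, 2 ≤ n →
        ∀ Y : Fin n → ℝ, (∀ j, Y j ∈ Icc a b) →
          C ^ n *
              ∏ j ∈ Finset.univ.filter (fun j : Fin n => (j : ℕ) ≠ 0),
                (⨅ i : {i : Fin n // i < j}, |Y j - Y i.1|) ^ 2 ≤
            ∏ j : Fin n, ⨅ i : {i : Fin n // i ≠ j}, |Y j - Y i.1| := by
  have hL : 0 < b - a + 1 := by linarith
  refine ⟨1 / (2 * (b - a + 1)), by positivity, fun n hn Y hY => ?_⟩
  obtain ⟨m, rfl⟩ := Nat.exists_eq_add_of_le' hn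
  refine le_trans ?_ (nnpb_ind (b - a + 1) hL m Y fun i j => ?_)
  · rw [Finset.prod_filter]
    refine mul_le_mul_of_nonneg_right ?_
      (Finset.prod_nonneg fun j _ => by split_ifs <;> positivity)
    refine pow_le_pow_of_le_one (by positivity) ?_ (by omega)
    rw [div_le_one (by positivity)]; linarith
  · have := hY i
    have := hY j
    simp only [mem_Icc] at *
    rw [abs_le]; constructor <;> linarith
end
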